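/- Let Ω be a Borel subset of ℝⁿ, let C ⊆ closure(Ω) be a nonempty closed set with λ(C ∩ Ω) = 0 and λ(C_δ ∩ Ω) > 0 for all δ > 0, and let μ be a density measure at C on Ω. Then μ is an extreme point of the convex set of all density measures at C on Ω (i.e., whenever μ(A) = t·μ₁(A) + (1−t)·μ₂(A) for all Borel A ⊆ Ω with density measures μ₁, μ₂ at C on Ω and t ∈ (0,1), one has μ₁ = μ₂ on all Borel subsets of Ω) if and only if μ(A) ∈ {0,1} for every Borel A ⊆ Ω. -/

import Mathlib

open MeasureTheory Metric Set Filter Topology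

noncomputable section

abbrev Eucl (n : ℕ) : Type := EuclideanSpace ℝ (Fin n)

/-- A finitely additive measure on the Borel subsets of `Ω`. -/
def IsFinAddOn {n : ℕ} (Ω : Set (Eucl n)) (μ : Set (Eucl n) → ℝ) : Prop :=
  μ ∅ = 0 ∧
  ∀ A B : Set (Eucl n), MeasurableSet A → MeasurableSet B → A ⊆ Ω → B ⊆ Ω →
    Disjoint A B → μ (A ∪ B) = μ A + μ B

/-- `μ` is a density measure at `C` on `Ω`. -/
def IsDensityMeasureAt {n : ℕ} (Ω C : Set (Eucl n)) (μ : Set (Eucl n) → ℝ) : Prop :=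
  IsFinAddOn Ω μ ∧
  (∀ A : Set (Eucl n), MeasurableSet A → A ⊆ Ω → 0 ≤ μ A) ∧
  (∀ A : Set (Eucl n), MeasurableSet A → A ⊆ Ω → volume A = 0 → μ A = 0) ∧
  μ Ω = 1 ∧
  ∀ δ : ℝ, 0 < δ → μ (thickening δ C ∩ Ω) = 1

theorem IsFinAddOn.inter_add_diff {n : ℕ} {Ω : Set (Eucl n)} {μ : Set (Eucl n) → ℝ}
    (h : IsFinAddOn Ω μ) {A B : Set (Eucl n)} (hA : MeasurableSet A) (hAΩ : A ⊆ Ω)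
    (hB : MeasurableSet B) : μ (A ∩ B) + μ (A \ B) = μ A := by
  rw [← h.2 (A ∩ B) (A \ B) (hA.inter hB) (hA.diff hB) (inter_subset_left.trans hAΩ)
    (sdiff_subset.trans hAΩ) (disjoint_sdiff_right.mono_left inter_subset_right),
    inter_union_sdiff]

theorem IsDensityMeasureAt.mono {n : ℕ} {Ω C : Set (Eucl n)} {μ : Set (Eucl n) → ℝ}
    (h : IsDensityMeasureAt Ω C μ) {A B : Set (Eucl n)} (hA : MeasurableSet A)
    (hB : MeasurableSet B) (hBΩ : B ⊆ Ω) (hAB : A ⊆ B) : μ A ≤ μ B := by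
  have h₁ := h.1.inter_add_diff hB hBΩ hA
  rw [inter_eq_self_of_subset_right hAB] at h₁
  linarith [h.2.1 (B \ A) (hB.diff hA) (sdiff_subset.trans hBΩ)]

/-- Conditioning a density measure on a set of positive measure gives a density measure. -/
theorem IsDensityMeasureAt.cond {n : ℕ} {Ω C : Set (Eucl n)} {μ : Set (Eucl n) → ℝ}
    (h : IsDensityMeasureAt Ω C μ) (hΩ : MeasurableSet Ω) {A : Set (Eucl n)}
    (hA : MeasurableSet A) (hAΩ : A ⊆ Ω) (hpos : 0 < μ A) :
    IsDensityMeasureAt Ω C (fun B ↦ μ (B ∩ A) / μ A) := by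
  obtain ⟨hadd, hnonneg, hnull, hone, hthick⟩ := id h
  refine ⟨⟨by simp [hadd.1], fun B D hB hD hBΩ hDΩ hBD ↦ ?_⟩, fun B hB hBΩ ↦ ?_,
    fun B hB hBΩ hB₀ ↦ ?_, ?_, fun δ hδ ↦ ?_⟩
  · dsimp only
    rw [union_inter_distrib_right, hadd.2 (B ∩ A) (D ∩ A) (hB.inter hA) (hD.inter hA)
      (inter_subset_left.trans hBΩ) (inter_subset_left.trans hDΩ)
      (hBD.mono inter_subset_left inter_subset_left), add_div]
  · exact div_nonneg (hnonneg _ (hB.inter hA) (inter_subset_left.trans hBΩ)) hpos.le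
  · dsimp only
    rw [hnull (B ∩ A) (hB.inter hA) (inter_subset_left.trans hBΩ)
      (measure_mono_null inter_subset_left hB₀), zero_div]
  · dsimp only
    rw [inter_eq_self_of_subset_right hAΩ, div_self hpos.ne']
  · have hT : MeasurableSet (thickening δ C ∩ Ω) := isOpen_thickening.measurableSet.inter hΩ
    have h₁ := hadd.inter_add_diff hΩ subset_rfl hT
    rw [inter_eq_self_of_subset_right inter_subset_right, hthick δ hδ, hone] at h₁
    have h₂ := hadd.inter_add_diff hA hAΩ hT
    have h₃ := h.mono (hA.diff hT) (hΩ.diff hT) sdiff_subset (sdiff_subset_sdiff_left hAΩ)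
    have h₄ := hnonneg _ (hA.diff hT) (sdiff_subset.trans hAΩ)
    dsimp only
    rw [inter_comm _ A, div_eq_one_iff_eq hpos.ne']
    linarith

theorem stmt9 {n : ℕ} (hn : 1 ≤ n) (Ω C : Set (Eucl n)) (hΩ : MeasurableSet Ω)
    (hC : IsClosed C) (hCne : C.Nonempty) (hCcl : C ⊆ closure Ω)
    (hCnull : volume (C ∩ Ω) = 0)
    (hpos : ∀ δ : ℝ, 0 < δ → 0 < volume (thickening δ C ∩ Ω))
    (μ : Set (Eucl n) → ℝ) (hμ : IsDensityMeasureAt Ω C μ) :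
    (∀ μ₁ μ₂ : Set (Eucl n) → ℝ, ∀ t : ℝ,
        IsDensityMeasureAt Ω C μ₁ → IsDensityMeasureAt Ω C μ₂ → t ∈ Ioo (0:ℝ) 1 →
        (∀ A : Set (Eucl n), MeasurableSet A → A ⊆ Ω →
          μ A = t * μ₁ A + (1 - t) * μ₂ A) →
        (∀ A : Set (Eucl n), MeasurableSet A → A ⊆ Ω → μ₁ A = μ₂ A)) ↔
    (∀ A : Set (Eucl n), MeasurableSet A → A ⊆ Ω → μ A = 0 ∨ μ A = 1) := by
  constructor
  · intro hext A hA hAΩ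
    by_contra! hne
    have hsplit := hμ.1.inter_add_diff hΩ subset_rfl hA
    rw [inter_eq_self_of_subset_right hAΩ, hμ.2.2.2.1] at hsplit
    have hA₀ : 0 < μ A := (hμ.2.1 A hA hAΩ).lt_of_ne' hne.1
    have hdiff : 0 < μ (Ω \ A) := by
      refine (hμ.2.1 _ (hΩ.diff hA) sdiff_subset).lt_of_ne' fun h ↦ hne.2 ?_
      linarith
    have heq := hext _ _ (μ A) (hμ.cond hΩ hA hAΩ hA₀)
      (hμ.cond hΩ (hΩ.diff hA) sdiff_subset hdiff) ⟨hA₀, by linarith⟩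
      (fun B hB hBΩ ↦ by
        have hBA : B ∩ (Ω \ A) = B \ A := by
          rw [← inter_sdiff_assoc, inter_eq_self_of_subset_left hBΩ]
        rw [hBA, show 1 - μ A = μ (Ω \ A) by linarith, mul_div_cancel₀ _ hA₀.ne',
          mul_div_cancel₀ _ hdiff.ne', hμ.1.inter_add_diff hB hBΩ hA]) A hA hAΩ
    simp [hμ.1.1, hA₀.ne'] at heq
  · intro h01 μ₁ μ₂ t h₁ h₂ ht hconv A hA hAΩ
    have h := hconv A hA hAΩ
    have hs : 0 < 1 - t := sub_pos.mpr ht.2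
    have n₁ := h₁.2.1 A hA hAΩ
    have n₂ := h₂.2.1 A hA hAΩ
    have u₁ := h₁.mono hA hΩ subset_rfl hAΩ
    have u₂ := h₂.mono hA hΩ subset_rfl hAΩ
    rw [h₁.2.2.2.1] at u₁
    rw [h₂.2.2.2.1] at u₂
    rcases h01 A hA hAΩ with h0 | h1
    · have e₁ : μ₁ A = 0 := by nlinarith [ht.1, mul_nonneg hs.le n₂]
      have e₂ : μ₂ A = 0 := by nlinarith [mul_nonneg ht.1.le n₁]
      rw [e₁, e₂]
    · have e₁ : μ₁ A = 1 := by
        nlinarith [ht.1, mul_nonneg hs.le (sub_nonneg.mpr u₂)]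
      have e₂ : μ₂ A = 1 := by
        nlinarith [mul_nonneg ht.1.le (sub_nonneg.mpr u₁)]
      rw [e₁, e₂]
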